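/- arXiv:2509.26196 — 2 statements merged into one kernel-verified Lean document; each statement's English description precedes it below -/
import Mathlib

section
/- Let (X,d) be a geodesic metric space equipped with its Borel σ-algebra. For y, z ∈ X write μ_{y,z} := (δ_y + δ_z)/2 and var(μ) := inf_{x∈X} ∫ d(x,w)² dμ(w). Suppose that for every pair of geodesics γ₁, γ₂ : [0,1] → X, the function t ↦ √(var(μ_{γ₁(t), γ₂(t)})) is convex on [0,1]. Then (X,d) is globally convex: for every pair of geodesics γ₁, γ₂ : [0,1] → X, the function t ↦ d(γ₁(t), γ₂(t)) is convex on [0,1]. -/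
open Set MeasureTheory

/-- A (minimizing) geodesic parametrized by `[0,1]`. -/
def IsUnitGeodesic {X : Type*} [MetricSpace X] (γ : ℝ → X) : Prop :=
  ∀ s ∈ Icc (0 : ℝ) 1, ∀ t ∈ Icc (0 : ℝ) 1,
    dist (γ s) (γ t) = |t - s| * dist (γ 0) (γ 1)

/-- `(X,d)` is a geodesic space: any two points are joined by a geodesic. -/
def IsGeodesicSpace (X : Type*) [MetricSpace X] : Prop :=
  ∀ x y : X, ∃ γ : ℝ → X, IsUnitGeodesic γ ∧ γ 0 = x ∧ γ 1 = y

/-- The measure `μ_{y,z} = (δ_y + δ_z)/2`. -/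
noncomputable def twoPointMeasure {X : Type*} [MeasurableSpace X] (y z : X) :
    Measure X :=
  (2 : ENNReal)⁻¹ • (Measure.dirac y + Measure.dirac z)

/-- The variance `var(μ) = inf_{x∈X} ∫ d(x,w)² dμ(w)`. -/
noncomputable def var {X : Type*} [MetricSpace X] [MeasurableSpace X]
    (μ : Measure X) : ℝ :=
  ⨅ x : X, ∫ w, dist x w ^ 2 ∂μ

theorem integral_twoPointMeasure {X : Type*} [MeasurableSpace X] [MeasurableSingletonClass X]
    (f : X → ℝ) (y z : X) : ∫ w, f w ∂twoPointMeasure y z = (f y + f z) / 2 := by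
  rw [twoPointMeasure, integral_smul_measure,
    integral_add_measure (integrable_dirac (by simp)) (integrable_dirac (by simp)),
    integral_dirac, integral_dirac]
  simp
  ring

theorem IsGeodesicSpace.var_twoPointMeasure {X : Type*} [MetricSpace X]
    [MeasurableSpace X] [BorelSpace X] (hgeo : IsGeodesicSpace X) (y z : X) :
    var (twoPointMeasure y z) = (dist y z / 2) ^ 2 := by
  simp only [var, integral_twoPointMeasure]
  have : Nonempty X := ⟨y⟩
  apply le_antisymm
  · obtain ⟨γ, hγ, rfl, rfl⟩ := hgeo y z
    have hleft : dist (γ (1 / 2)) (γ 0) = dist (γ 0) (γ 1) / 2 := by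
      rw [hγ (1 / 2) ⟨by norm_num, by norm_num⟩ 0 ⟨le_rfl, zero_le_one⟩]
      norm_num [abs_of_pos]
      ring
    have hright : dist (γ (1 / 2)) (γ 1) = dist (γ 0) (γ 1) / 2 := by
      rw [hγ (1 / 2) ⟨by norm_num, by norm_num⟩ 1 ⟨zero_le_one, le_rfl⟩]
      norm_num [abs_of_pos]
      ring
    refine (ciInf_le ⟨0, ?_⟩ (γ (1 / 2))).trans_eq ?_
    · rintro _ ⟨x, rfl⟩
      positivity
    · rw [hleft, hright]
      ring
  · refine le_ciInf fun x => ?_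
    have htri := dist_triangle_left y z x
    have hsq := pow_le_pow_left₀ dist_nonneg htri 2
    linarith [sq_nonneg (dist x y - dist x z)]

/-- 'If' direction of Proposition 5.4 (Kim–Pass): if in a geodesic metric space
`t ↦ √(var((δ_{γ₁(t)} + δ_{γ₂(t)})/2))` is convex on `[0,1]` for every pair of
geodesics `γ₁, γ₂`, then `(X,d)` is globally convex. -/
theorem globally_convex_of_convex_sqrt_var {X : Type*} [MetricSpace X]
    [MeasurableSpace X] [BorelSpace X] (hgeo : IsGeodesicSpace X)
    (h : ∀ γ₁ γ₂ : ℝ → X, IsUnitGeodesic γ₁ → IsUnitGeodesic γ₂ →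
      ConvexOn ℝ (Icc (0 : ℝ) 1)
        (fun t => Real.sqrt (var (twoPointMeasure (γ₁ t) (γ₂ t))))) :
    ∀ γ₁ γ₂ : ℝ → X, IsUnitGeodesic γ₁ → IsUnitGeodesic γ₂ →
      ConvexOn ℝ (Icc (0 : ℝ) 1) (fun t => dist (γ₁ t) (γ₂ t)) := by
  intro γ₁ γ₂ hγ₁ hγ₂
  have hconv := (h γ₁ γ₂ hγ₁ hγ₂).smul zero_le_two
  refine hconv.congr fun t _ => ?_
  simp only [hgeo.var_twoPointMeasure, smul_eq_mul]
  rw [Real.sqrt_sq (by positivity)]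
  ring
end

section
/- Let (X,d) be a globally convex metric space, and let C([0,1],X) denote the space of continuous maps [0,1] → X with the topology of uniform convergence and its Borel σ-algebra. Let Π be a probability measure on C([0,1],X) such that Π-almost every η is a geodesic, and let x₀, x₁ ∈ X satisfy ∫ d(x₀, η(0))² dΠ(η) < ∞ and ∫ d(x₁, η(1))² dΠ(η) < ∞. Let γ : [0,1] → X be a geodesic with γ(0) = x₀ and γ(1) = x₁. Then for every t ∈ [0,1], (∫ d(γ(t), η(t))² dΠ(η))^{1/2} ≤ (1−t) · (∫ d(x₀, η(0))² dΠ(η))^{1/2} + t · (∫ d(x₁, η(1))² dΠ(η))^{1/2}. -/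
open Set MeasureTheory

/-- `(X,d)` is globally convex (Busemann nonpositive curvature). -/
def GloballyConvex (X : Type*) [MetricSpace X] : Prop :=
  ∀ γ₁ γ₂ : ℝ → X, IsUnitGeodesic γ₁ → IsUnitGeodesic γ₂ →
    ConvexOn ℝ (Icc (0 : ℝ) 1) (fun t => dist (γ₁ t) (γ₂ t))

/-- A continuous map `η : [0,1] → X` which is a (minimizing) geodesic. -/
def IsGeodesicMap {X : Type*} [MetricSpace X] (η : C(Icc (0 : ℝ) 1, X)) :
    Prop :=
  ∀ s t : Icc (0 : ℝ) 1,
    dist (η s) (η t) =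
      |(t : ℝ) - (s : ℝ)| * dist (η ⟨0, by norm_num⟩) (η ⟨1, by norm_num⟩)

theorem IsGeodesicMap.isUnitGeodesic_extend {X : Type*} [MetricSpace X]
    {η : C(Icc (0 : ℝ) 1, X)} (hη : IsGeodesicMap η) :
    IsUnitGeodesic (IccExtend zero_le_one η) := by
  intro s hs t ht
  rw [IccExtend_of_mem _ _ hs, IccExtend_of_mem _ _ ht, hη,
    IccExtend_of_mem _ _ (left_mem_Icc.2 zero_le_one),
    IccExtend_of_mem _ _ (right_mem_Icc.2 zero_le_one)]

/-- In a globally convex space, the distance between two geodesics lies below the chord joining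
the distances between their endpoints. -/
theorem GloballyConvex.dist_le {X : Type*} [MetricSpace X] (hconv : GloballyConvex X)
    {γ : ℝ → X} (hγ : IsUnitGeodesic γ) {η : C(Icc (0 : ℝ) 1, X)} (hη : IsGeodesicMap η)
    (t : Icc (0 : ℝ) 1) :
    dist (γ t) (η t) ≤
      (1 - (t : ℝ)) * dist (γ 0) (η ⟨0, by norm_num⟩) +
        (t : ℝ) * dist (γ 1) (η ⟨1, by norm_num⟩) := by
  have h := (hconv γ _ hγ hη.isUnitGeodesic_extend).2 (left_mem_Icc.2 zero_le_one)
    (right_mem_Icc.2 zero_le_one) (sub_nonneg.2 t.2.2) t.2.1 (sub_add_cancel _ _)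
  simp only [smul_eq_mul, mul_zero, mul_one, zero_add] at h
  rwa [IccExtend_of_mem _ _ t.2, IccExtend_of_mem _ _ (left_mem_Icc.2 zero_le_one),
    IccExtend_of_mem _ _ (right_mem_Icc.2 zero_le_one)] at h

/-- The Cauchy-Schwarz inequality for nonnegative square-integrable functions. -/
theorem integral_mul_le_sqrt_mul_sqrt {Ω : Type*} [MeasurableSpace Ω] {μ : Measure Ω}
    {f g : Ω → ℝ} (hf : MemLp f 2 μ) (hg : MemLp g 2 μ) (hf0 : 0 ≤ f) (hg0 : 0 ≤ g) :
    ∫ ω, f ω * g ω ∂μ ≤ √(∫ ω, f ω ^ 2 ∂μ) * √(∫ ω, g ω ^ 2 ∂μ) := by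
  have h := integral_mul_le_Lp_mul_Lq_of_nonneg (μ := μ) Real.HolderConjugate.two_two
    (.of_forall hf0) (.of_forall hg0) (by simpa using hf) (by simpa using hg)
  simpa only [Real.rpow_two, ← Real.sqrt_eq_rpow] using h

/-- The Minkowski inequality in `L²` for nonnegative combinations, for a function that need not
be measurable. -/
theorem sqrt_integral_sq_le_of_ae_le {Ω : Type*} [MeasurableSpace Ω] {μ : Measure Ω}
    {f g h : Ω → ℝ} (hf : MemLp f 2 μ) (hg : MemLp g 2 μ) (hf0 : 0 ≤ f) (hg0 : 0 ≤ g)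
    (hh0 : 0 ≤ h) {a b : ℝ} (ha : 0 ≤ a) (hb : 0 ≤ b)
    (hle : ∀ᵐ ω ∂μ, h ω ≤ a * f ω + b * g ω) :
    √(∫ ω, h ω ^ 2 ∂μ) ≤ a * √(∫ ω, f ω ^ 2 ∂μ) + b * √(∫ ω, g ω ^ 2 ∂μ) := by
  have hfi := hf.integrable_sq.const_mul (a ^ 2)
  have hgi := hg.integrable_sq.const_mul (b ^ 2)
  have hfgi : Integrable (fun ω => 2 * a * b * (f ω * g ω)) μ :=
    (hf.integrable_mul hg).const_mul _
  have hmono : ∫ ω, h ω ^ 2 ∂μ ≤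
      ∫ ω, a ^ 2 * f ω ^ 2 + 2 * a * b * (f ω * g ω) + b ^ 2 * g ω ^ 2 ∂μ := by
    refine integral_mono_of_nonneg (.of_forall fun ω => sq_nonneg _) ((hfi.add hfgi).add hgi) ?_
    filter_upwards [hle] with ω hω
    calc h ω ^ 2 ≤ (a * f ω + b * g ω) ^ 2 := pow_le_pow_left₀ (hh0 ω) hω 2
      _ = _ := by ring
  rw [integral_add (by exact hfi.add hfgi) hgi, integral_add hfi hfgi] at hmono
  simp only [integral_const_mul] at hmono
  have hcs := mul_le_mul_of_nonneg_left (integral_mul_le_sqrt_mul_sqrt hf hg hf0 hg0)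
    (by positivity : 0 ≤ 2 * a * b)
  have hF := Real.sq_sqrt (integral_nonneg fun ω => sq_nonneg (f ω) : 0 ≤ ∫ ω, f ω ^ 2 ∂μ)
  have hG := Real.sq_sqrt (integral_nonneg fun ω => sq_nonneg (g ω) : 0 ≤ ∫ ω, g ω ^ 2 ∂μ)
  refine Real.sqrt_le_iff.2 ⟨by positivity, ?_⟩
  rw [add_sq, mul_pow, mul_pow, hF, hG]
  linarith

/-- Main estimate in the 'only if' direction of Proposition 5.4 (Kim–Pass):
in a globally convex metric space, for a probability measure `Π` on
`C([0,1],X)` concentrated on geodesics with square-integrable distances of the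
endpoint evaluations to `x₀`, `x₁`, and a geodesic `γ` from `x₀` to `x₁`,
the `L²(Π)`-norm of `η ↦ d(γ(t), η(t))` satisfies the chord inequality. -/
theorem kim_pass_main_estimate {X : Type*} [MetricSpace X]
    [MeasurableSpace C(Icc (0 : ℝ) 1, X)] [BorelSpace C(Icc (0 : ℝ) 1, X)]
    (hconv : GloballyConvex X)
    (P : Measure C(Icc (0 : ℝ) 1, X)) [IsProbabilityMeasure P]
    (hgeo : ∀ᵐ η ∂P, IsGeodesicMap η) (x₀ x₁ : X)
    (h0 : Integrable (fun η : C(Icc (0 : ℝ) 1, X) =>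
      dist x₀ (η ⟨0, by norm_num⟩) ^ 2) P)
    (h1 : Integrable (fun η : C(Icc (0 : ℝ) 1, X) =>
      dist x₁ (η ⟨1, by norm_num⟩) ^ 2) P)
    (γ : ℝ → X) (hγ : IsUnitGeodesic γ) (hγ0 : γ 0 = x₀) (hγ1 : γ 1 = x₁) :
    ∀ t : Icc (0 : ℝ) 1,
      Real.sqrt (∫ η, dist (γ t) (η t) ^ 2 ∂P) ≤
        (1 - (t : ℝ)) *
            Real.sqrt (∫ η, dist x₀ (η ⟨0, by norm_num⟩) ^ 2 ∂P) +
          (t : ℝ) * Real.sqrt (∫ η, dist x₁ (η ⟨1, by norm_num⟩) ^ 2 ∂P) := by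
  subst hγ0 hγ1
  intro t
  have memLp (x : X) (s : Icc (0 : ℝ) 1)
      (h : Integrable (fun η : C(Icc (0 : ℝ) 1, X) => dist x (η s) ^ 2) P) :
      MemLp (fun η : C(Icc (0 : ℝ) 1, X) => dist x (η s)) 2 P :=
    (memLp_two_iff_integrable_sq
      (continuous_const.dist (continuous_eval_const s)).measurable.aestronglyMeasurable).2 h
  refine sqrt_integral_sq_le_of_ae_le (memLp _ _ h0) (memLp _ _ h1) (fun _ => dist_nonneg)
    (fun _ => dist_nonneg) (fun _ => dist_nonneg) (sub_nonneg.2 t.2.2) t.2.1 ?_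
  filter_upwards [hgeo] with η hη
  exact hconv.dist_le hγ hη t
end
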